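/- Let f be meromorphic on a domain Ω ⊆ ℂ and suppose there exist M > 0, a subdomain U ⊆ Ω, and an analytic F : U → ℂ with f = e^F on U such that F maps U univalently onto the half-plane {Re w > log M}. Then the equation ż = f(z) has infinitely many pairwise disjoint trajectories z(t), each of which tends in finite increasing time from within U to the extended boundary of Ω. -/

import Mathlib

section HalfPlane

open Complex Set Filter Topology Metric

/-- On a half-plane, a holomorphic function has a primitive. -/
theorem exists_primitive_halfPlane {c : ℝ} {h : ℂ → ℂ}
    (hh : DifferentiableOn ℂ h {w | c < w.re}) :
    ∃ g : ℂ → ℂ, ∀ w : ℂ, c < w.re → HasDerivAt g (h w) w := by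
  let τ : ℂ → ℂ := fun u => c + (1 + u) / (1 - u)
  have hne : ∀ u ∈ ball (0 : ℂ) 1, (1 : ℂ) - u ≠ 0 := by
    intro u hu h0
    rw [mem_ball_zero_iff, ← sub_eq_zero.1 h0] at hu
    simp at hu
  have hτ : ∀ u ∈ ball (0 : ℂ) 1, c < (τ u).re := by
    intro u hu
    have h1 : 0 < normSq (1 - u) := normSq_pos.2 (hne u hu)
    have h2 : normSq u < 1 := by
      rw [normSq_eq_norm_sq]
      rw [mem_ball_zero_iff] at hu
      nlinarith [norm_nonneg u]
    have h3 : ((1 + u) / (1 - u)).re = (1 - normSq u) / normSq (1 - u) := by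
      rw [div_re, ← add_div]
      congr 1
      simp [normSq_apply]
      ring
    simp only [τ, add_re, ofReal_re, h3]
    have : 0 < (1 - normSq u) / normSq (1 - u) := div_pos (by linarith) h1
    linarith
  have hd : DifferentiableOn ℂ (fun u => h (τ u) * (2 / (1 - u) ^ 2)) (ball 0 1) := by
    have hτd : DifferentiableOn ℂ τ (ball 0 1) := fun u hu =>
      DifferentiableAt.differentiableWithinAt (by have := hne u hu; fun_prop (disch := assumption))
    refine (hh.comp hτd hτ).mul fun u hu => DifferentiableAt.differentiableWithinAt ?_
    have := pow_ne_zero 2 (hne u hu)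
    fun_prop (disch := assumption)
  obtain ⟨g, hg⟩ := hd.isExactOn_ball
  refine ⟨fun w => g ((w - c - 1) / (w - c + 1)), fun w hw => ?_⟩
  have h1 : w - c + 1 ≠ 0 := by
    intro h0
    have := congrArg re h0
    simp at this
    linarith
  have hu : (w - c - 1) / (w - c + 1) ∈ ball (0 : ℂ) 1 := by
    rw [mem_ball_zero_iff, norm_div, div_lt_one (norm_pos_iff.2 h1)]
    apply lt_of_pow_lt_pow_left₀ 2 (norm_nonneg _)
    rw [← normSq_eq_norm_sq, ← normSq_eq_norm_sq, normSq_apply, normSq_apply]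
    simp
    nlinarith
  have e1 : 1 - (w - c - 1) / (w - c + 1) = 2 / (w - c + 1) := by field_simp; ring
  have e2 : τ ((w - c - 1) / (w - c + 1)) = w := by
    simp only [τ, e1]; field_simp; ring
  have h2 := hg _ hu
  beta_reduce at h2
  rw [e2, e1] at h2
  have h3 : HasDerivAt (fun w : ℂ => (w - c - 1) / (w - c + 1))
      ((1 * (w - c + 1) - (w - c - 1) * 1) / (w - c + 1) ^ 2) w :=
    (((hasDerivAt_id w).sub_const _).sub_const _).div
      (((hasDerivAt_id w).sub_const _).add_const _) h1
  convert! HasDerivAt.comp w h2 h3 using 1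
  field_simp
  ring

/-- An injective holomorphic function has a nonvanishing derivative and its inverse is
holomorphic. -/
theorem injOn_inverse {F : ℂ → ℂ} {U : Set ℂ} (hUo : IsOpen U)
    (hF : DifferentiableOn ℂ F U) (hFi : InjOn F U) :
    IsOpen (F '' U) ∧ (∀ z ∈ U, deriv F z ≠ 0) ∧
      ∀ φ : ℂ → ℂ, (∀ z ∈ U, φ (F z) = z) → DifferentiableOn ℂ φ (F '' U) := by
  have hA : AnalyticOnNhd ℂ F U := hF.analyticOnNhd hUo
  have hmap : ∀ z ∈ U, 𝓝 (F z) ≤ map F (𝓝 z) := by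
    intro z hz
    refine (hA z hz).eventually_constant_or_nhds_le_map_nhds.resolve_left fun h => ?_
    have h2 : ∀ᶠ x in 𝓝[≠] z, False := by
      filter_upwards [h.filter_mono nhdsWithin_le_nhds, self_mem_nhdsWithin,
        nhdsWithin_le_nhds (hUo.mem_nhds hz)] with x hx hne hxU
      exact hne (hFi hxU hz hx)
    exact h2.exists.elim fun _ h => h
  have hop : ∀ s ⊆ U, IsOpen s → IsOpen (F '' s) := by
    intro s hs hso
    refine isOpen_iff_mem_nhds.2 ?_
    rintro _ ⟨z, hz, rfl⟩
    exact hmap z (hs hz) (image_mem_map (hso.mem_nhds hz))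
  have hcont : ∀ φ : ℂ → ℂ, (∀ z ∈ U, φ (F z) = z) → ∀ z ∈ U, ContinuousAt φ (F z) := by
    intro φ hφ z hz s hs
    rw [hφ z hz] at hs
    have h1 : F '' (s ∩ U) ∈ 𝓝 (F z) := hmap z hz (image_mem_map (inter_mem hs (hUo.mem_nhds hz)))
    refine mem_map.2 (mem_of_superset h1 ?_)
    rintro _ ⟨x, ⟨hxs, hxU⟩, rfl⟩
    rw [mem_preimage, hφ x hxU]
    exact hxs
  have hright : ∀ φ : ℂ → ℂ, (∀ z ∈ U, φ (F z) = z) → ∀ y ∈ F '' U, F (φ y) = y := by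
    rintro φ hφ _ ⟨z, hz, rfl⟩
    rw [hφ z hz]
  have hreg : ∀ φ : ℂ → ℂ, (∀ z ∈ U, φ (F z) = z) → ∀ z ∈ U, deriv F z ≠ 0 →
      DifferentiableAt ℂ φ (F z) := by
    intro φ hφ z hz hd
    refine (HasDerivAt.of_local_left_inverse (hcont φ hφ z hz) (f := F) (f' := deriv F z) ?_ hd
      ?_).differentiableAt
    · rw [hφ z hz]
      exact (hA z hz).differentiableAt.hasDerivAt
    · filter_upwards [(hop U le_rfl hUo).mem_nhds (mem_image_of_mem F hz)] with y hy
      exact hright φ hφ y hy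
  have hdiff : ∀ φ : ℂ → ℂ, (∀ z ∈ U, φ (F z) = z) → ∀ z ∈ U, DifferentiableAt ℂ φ (F z) := by
    intro φ hφ z hz
    have hev : ∀ᶠ x in 𝓝[≠] z, deriv F x ≠ 0 := by
      refine ((hA z hz).deriv.eventually_eq_zero_or_eventually_ne_zero).resolve_left fun h => ?_
      obtain ⟨r, hr, hball⟩ := Metric.eventually_nhds_iff_ball.1 (h.and (hUo.mem_nhds hz))
      have hc : ∀ x ∈ ball z r, F x = F z := fun x hx =>
        (convex_ball z r).is_const_of_fderivWithin_eq_zero (𝕜 := ℂ)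
          (fun y hy => ((hA y (hball y hy).2).differentiableAt).differentiableWithinAt)
          (fun y hy => by
            rw [fderivWithin_of_isOpen isOpen_ball hy]
            ext; simp [(hball y hy).1]) hx (mem_ball_self hr)
      have h2 : ∀ᶠ x in 𝓝[≠] z, False := by
        filter_upwards [nhdsWithin_le_nhds (ball_mem_nhds z hr), self_mem_nhdsWithin] with x hx hne
        exact hne (hFi (hball x hx).2 hz (hc x hx))
      exact h2.exists.elim fun _ h => h
    rw [eventually_nhdsWithin_iff] at hev
    obtain ⟨r, hr, hball⟩ := Metric.eventually_nhds_iff_ball.1 (hev.and (hUo.mem_nhds hz))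
    have hs : F '' ball z r ∈ 𝓝 (F z) :=
      (hop _ (fun x hx => (hball x hx).2) isOpen_ball).mem_nhds
        (mem_image_of_mem F (mem_ball_self hr))
    refine ((differentiableOn_compl_singleton_and_continuousAt_iff hs).1
      ⟨?_, hcont φ hφ z hz⟩).differentiableAt hs
    rintro _ ⟨⟨x, hx, rfl⟩, hne⟩
    refine (hreg φ hφ x (hball x hx).2 ((hball x hx).1 ?_)).differentiableWithinAt
    rintro rfl
    exact hne rfl
  refine ⟨hop U le_rfl hUo, fun z hz h0 => ?_, fun φ hφ => ?_⟩
  · have h1 := hdiff _ (fun x hx => hFi.leftInvOn_invFunOn hx) z hz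
    have h2 := h1.hasDerivAt.comp z (hA z hz).differentiableAt.hasDerivAt
    have h3 : HasDerivAt (Function.invFunOn F U ∘ F) 1 z := by
      refine (hasDerivAt_id z).congr_of_eventuallyEq ?_
      filter_upwards [hUo.mem_nhds hz] with x hx using hFi.leftInvOn_invFunOn hx
    have := h2.unique h3
    simp [h0] at this
  · rintro _ ⟨z, hz, rfl⟩
    exact (hdiff φ hφ z hz).differentiableWithinAt

theorem le_norm_deriv_of_ball_subset_image {f : ℂ → ℂ} (hf : DifferentiableOn ℂ f (ball 0 1))
    (hi : InjOn f (ball 0 1)) {d : ℝ} (hd : ball (f 0) d ⊆ f '' ball 0 1) : d ≤ ‖deriv f 0‖ := by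
  have h0 : (0 : ℂ) ∈ ball (0 : ℂ) 1 := mem_ball_self one_pos
  have hψ := (injOn_inverse isOpen_ball hf hi).2.2 (Function.invFunOn f (ball 0 1))
    fun x hx => hi.leftInvOn_invFunOn hx
  set ψ := Function.invFunOn f (ball 0 1) with hψdef
  refine le_of_forall_lt fun R hR => ?_
  rcases le_or_gt R 0 with hR0 | hR0
  · refine hR0.trans_lt (norm_pos_iff.2 ((injOn_inverse isOpen_ball hf hi).2.1 0 h0))
  obtain ⟨R', hRR', hR'd⟩ := exists_between hR
  have hR' : 0 < R' := hR0.trans hRR'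
  have hsub : closedBall (f 0) R' ⊆ f '' ball 0 1 := (closedBall_subset_ball hR'd).trans hd
  have h1 : ‖deriv ψ (f 0)‖ ≤ 1 / R' := by
    refine norm_deriv_le_of_forall_mem_sphere_norm_le hR'
      (DifferentiableOn.diffContOnCl ?_) fun z hz => ?_
    · exact hψ.mono ((closure_ball_subset_closedBall).trans hsub)
    · have := Function.invFunOn_mem (hsub (sphere_subset_closedBall hz))
      rw [mem_ball_zero_iff] at this
      exact this.le
  have hψ0 : DifferentiableAt ℂ ψ (f 0) := hψ.differentiableAt
    ((injOn_inverse isOpen_ball hf hi).1.mem_nhds (mem_image_of_mem f h0))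
  have h2 : deriv ψ (f 0) * deriv f 0 = 1 := by
    refine (hψ0.hasDerivAt.comp 0
      (hf.differentiableAt (isOpen_ball.mem_nhds h0)).hasDerivAt).unique ?_
    refine (hasDerivAt_id 0).congr_of_eventuallyEq ?_
    filter_upwards [isOpen_ball.mem_nhds h0] with x hx using hi.leftInvOn_invFunOn hx
  have h3 : ‖deriv ψ (f 0)‖ * ‖deriv f 0‖ = 1 := by rw [← norm_mul, h2, norm_one]
  have h4 : 1 ≤ 1 / R' * ‖deriv f 0‖ :=
    h3.symm.trans_le (mul_le_mul_of_nonneg_right h1 (norm_nonneg _))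
  have h5 : R' ≤ ‖deriv f 0‖ := by
    rw [one_div, inv_mul_eq_div, le_div_iff₀ hR'] at h4
    linarith
  exact hRR'.trans_le h5

/-- A holomorphic branch of the square root of a nonvanishing function on the unit disc. -/
theorem exists_sqrt_ball {g : ℂ → ℂ} (hg : DifferentiableOn ℂ g (ball 0 1))
    (hne : ∀ u ∈ ball (0 : ℂ) 1, g u ≠ 0) (hg0 : g 0 = 1) :
    ∃ h : ℂ → ℂ, DifferentiableOn ℂ h (ball 0 1) ∧ h 0 = 1 ∧ ∀ u, h u ^ 2 = g u := by
  have hsc : IsSimplyConnected (ball (0 : ℂ) 1) :=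
    have := (convex_ball (0 : ℂ) 1).contractibleSpace (nonempty_ball.2 one_pos)
    (inferInstance : SimplyConnectedSpace (ball (0 : ℂ) 1))
  obtain ⟨h, hc, hsq⟩ := exists_continuousOn_pow_eq hsc isOpen_ball hg.continuousOn
    (by rintro ⟨u, hu, h0⟩; exact hne u hu h0) two_ne_zero
  have hd : DifferentiableOn ℂ h (ball 0 1) := by
    intro u hu
    have hu' := isOpen_ball.mem_nhds hu
    have hhu : h u ≠ 0 := by
      intro h0
      apply hne u hu
      rw [← hsq, h0, zero_pow two_ne_zero]
    refine (HasDerivAt.of_comp_left (f := fun z => z ^ 2) (h := g) (hc.continuousAt hu')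
      (hasDerivAt_pow 2 (h u)) (hg.differentiableAt hu').hasDerivAt (by simpa using hhu)
      (Eventually.of_forall hsq)).differentiableAt.differentiableWithinAt
  have h1 : h 0 ^ 2 = 1 := by rw [hsq, hg0]
  refine ⟨fun u => h u * h 0, hd.mul_const _, by simp only [← sq, h1], fun u => ?_⟩
  rw [mul_pow, h1, mul_one, hsq]

/-- A crude second coefficient estimate for univalent functions on the unit disc. -/
theorem exists_norm_deriv_deriv_le_of_injOn : ∃ C : ℝ, 0 < C ∧ ∀ f : ℂ → ℂ,
    DifferentiableOn ℂ f (ball 0 1) → InjOn f (ball 0 1) →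
      ‖deriv (deriv f) 0‖ ≤ C * ‖deriv f 0‖ := by
  refine ⟨20000, by norm_num, fun f hf hi => ?_⟩
  have h0 : (0 : ℂ) ∈ ball (0 : ℂ) 1 := mem_ball_self one_pos
  set V := f '' ball 0 1 with hV
  have hVo : IsOpen V := (injOn_inverse isOpen_ball hf hi).1
  have hne : Vᶜ.Nonempty := by
    by_contra h
    rw [not_nonempty_iff_eq_empty, compl_empty_iff] at h
    have := le_norm_deriv_of_ball_subset_image hf hi (d := ‖deriv f 0‖ + 1)
      (by rw [← hV, h]; exact subset_univ _)
    linarith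
  obtain ⟨a, ha, had⟩ := hVo.isClosed_compl.exists_infDist_eq_dist hne (f 0)
  set d := dist (f 0) a with hd
  have hdV : ball (f 0) d ⊆ V := by
    rw [← had]
    intro y hy
    by_contra hyV
    have := infDist_le_dist_of_mem (x := f 0) (show y ∈ Vᶜ from hyV)
    rw [mem_ball, dist_comm] at hy
    linarith
  have hdle := le_norm_deriv_of_ball_subset_image hf hi hdV
  set b := a - f 0 with hb
  have hbd : ‖b‖ = d := by rw [hd, dist_comm, dist_eq_norm]
  have hb0 : b ≠ 0 := by
    intro h
    apply ha
    rw [sub_eq_zero.1 h]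
    exact mem_image_of_mem f h0
  have hdpos : 0 < d := hbd ▸ norm_pos_iff.2 hb0
  obtain ⟨h, hhd, hh0, hsq⟩ := exists_sqrt_ball (g := fun u => 1 - (f u - f 0) / b)
    (((hf.sub_const _).div_const _).const_sub _) (by
      intro u hu h1
      apply ha
      have : f u = a := by
        rw [sub_eq_zero, eq_comm, div_eq_one_iff_eq hb0, hb] at h1
        linear_combination h1
      exact this ▸ mem_image_of_mem f hu) (by simp)
  have hfh : ∀ u, f u = f 0 + b * (1 - h u ^ 2) := by
    intro u
    rw [hsq]
    field_simp
    ring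
  have hre : ∀ u ∈ ball (0 : ℂ) 1, f u ∈ ball (f 0) d → 0 < (h u).re := by
    intro u hu hfu
    have hψ := (injOn_inverse isOpen_ball hf hi).2.2 (Function.invFunOn f (ball 0 1))
      fun x hx => hi.leftInvOn_invFunOn hx
    set ψ := Function.invFunOn f (ball 0 1) with hψdef
    have hψm : ∀ y ∈ V, ψ y ∈ ball (0 : ℂ) 1 := fun y hy => Function.invFunOn_mem hy
    have hc : ContinuousOn (fun y => (h (ψ y)).re) (ball (f 0) d) :=
      continuous_re.comp_continuousOn
        (hhd.continuousOn.comp (hψ.continuousOn.mono hdV) fun y hy => hψm y (hdV hy))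
    by_contra hneg
    have h1 : (h (ψ (f u))).re ≤ 0 := by
      rw [hψdef, hi.leftInvOn_invFunOn hu]
      exact not_lt.1 hneg
    have h2 : 0 ≤ (h (ψ (f 0))).re := by
      rw [hψdef, hi.leftInvOn_invFunOn h0, hh0]
      simp
    obtain ⟨y, hy, hy0⟩ := (convex_ball (f 0) d).isPreconnected.intermediate_value hfu
      (mem_ball_self hdpos) hc ⟨h1, h2⟩
    have hfy : f (ψ y) = y := Function.invFunOn_eq (hdV hy)
    have h3 : h (ψ y) ^ 2 = 1 - (y - f 0) / b := by rw [hsq, hfy]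
    have h4 : ‖(y - f 0) / b‖ < 1 := by
      rw [norm_div, hbd, div_lt_one hdpos, ← dist_eq_norm]
      exact hy
    have h5 := (re_le_norm ((y - f 0) / b)).trans_lt h4
    have h6 := congrArg re h3
    simp only [sq, mul_re, sub_re, one_re] at h6
    simp only at hy0
    rw [hy0] at h6
    nlinarith [mul_self_nonneg (h (ψ y)).im]
  have hlow : ∀ u ∈ ball (0 : ℂ) 1, 1 / 4 ≤ ‖h u + 1‖ := by
    intro u hu
    by_cases hfu : f u ∈ ball (f 0) d
    · have h1 := hre u hu hfu
      have h2 := re_le_norm (h u + 1)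
      simp only [add_re, one_re] at h2
      linarith
    · rw [mem_ball, dist_eq_norm, not_lt] at hfu
      by_contra hlt
      rw [not_le] at hlt
      have h1 : f u - f 0 = b * ((h u + 1) * (2 - (h u + 1))) := by rw [hfh u]; ring
      rw [h1, norm_mul, hbd, norm_mul] at hfu
      have h2 : ‖2 - (h u + 1)‖ ≤ 2 + ‖h u + 1‖ := by
        refine (norm_sub_le _ _).trans ?_
        simp
      have h3 : ‖h u + 1‖ * ‖2 - (h u + 1)‖ < 1 := by
        nlinarith [norm_nonneg (h u + 1), norm_nonneg (2 - (h u + 1))]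
      nlinarith
  have hpne : ∀ u ∈ ball (0 : ℂ) 1, h u + 1 ≠ 0 := by
    intro u hu h1
    have := hlow u hu
    rw [h1, norm_zero] at this
    linarith
  set k : ℂ → ℂ := fun u => (h u + 1)⁻¹ with hk
  have hkd : DifferentiableOn ℂ k (ball 0 1) := (hhd.add_const _).inv hpne
  have hkb : ∀ u ∈ ball (0 : ℂ) 1, ‖k u‖ ≤ 4 := by
    intro u hu
    rw [hk, norm_inv]
    exact (inv_anti₀ (by norm_num) (hlow u hu)).trans_eq (by norm_num)
  have hk'b : ∀ u ∈ closedBall (0 : ℂ) (1 / 2), ‖deriv k u‖ ≤ 16 := by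
    intro u hu
    have hsub : closedBall u (1 / 4) ⊆ ball (0 : ℂ) 1 := by
      intro y hy
      rw [mem_closedBall] at hu hy
      rw [mem_ball]
      linarith [dist_triangle y u 0]
    refine (norm_deriv_le_of_forall_mem_sphere_norm_le (R := 1 / 4) (C := 4) (by norm_num)
      (DifferentiableOn.diffContOnCl (hkd.mono (closure_ball_subset_closedBall.trans hsub)))
      fun z hz => hkb z (hsub (sphere_subset_closedBall hz))).trans (by norm_num)
  have hk'd : DifferentiableOn ℂ (deriv k) (ball 0 1) := hkd.deriv isOpen_ball
  have hk''b : ‖deriv (deriv k) 0‖ ≤ 32 := by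
    refine (norm_deriv_le_of_forall_mem_sphere_norm_le (R := 1 / 2) (C := 16) (by norm_num)
      (DifferentiableOn.diffContOnCl (hk'd.mono (closure_ball_subset_closedBall.trans
        (closedBall_subset_ball (by norm_num)))))
      fun z hz => hk'b z (sphere_subset_closedBall hz)).trans (by norm_num)
  have hkne : ∀ u ∈ ball (0 : ℂ) 1, k u ≠ 0 := fun u hu => inv_ne_zero (hpne u hu)
  have hfk : ∀ u ∈ ball (0 : ℂ) 1, f u = f 0 + b * (2 * (k u)⁻¹ - (k u ^ 2)⁻¹) := by
    intro u hu
    rw [hfh u, hk]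
    simp only [inv_inv, inv_pow]
    ring
  have hf' : ∀ u ∈ ball (0 : ℂ) 1,
      deriv f u = 2 * b * (deriv k u * ((k u ^ 3)⁻¹ - (k u ^ 2)⁻¹)) := by
    intro u hu
    have hu' := isOpen_ball.mem_nhds hu
    have h1 := (hkd.differentiableAt hu').hasDerivAt
    have h2 := (((((h1.inv (hkne u hu)).const_mul 2).sub
      ((h1.pow 2).inv (pow_ne_zero 2 (hkne u hu)))).const_mul b).const_add (f 0))
    have h3 := (h2.congr_of_eventuallyEq (f₁ := f) (by
      filter_upwards [hu'] with x hx
      rw [hfk x hx]; rfl)).deriv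
    rw [h3]
    have := hkne u hu
    simp only [Pi.pow_apply]
    field_simp
    ring
  have hk0 : k 0 = 1 / 2 := by rw [hk]; simp only [hh0]; norm_num
  have hf'' : deriv (deriv f) 0 = 2 * b * (deriv (deriv k) 0 * 4 - 32 * deriv k 0 ^ 2) := by
    have hu' := isOpen_ball.mem_nhds h0
    have h1 := (hkd.differentiableAt hu').hasDerivAt
    have h2 := (hk'd.differentiableAt hu').hasDerivAt
    have h3 := (h2.mul (((h1.pow 3).inv (pow_ne_zero 3 (hkne 0 h0))).sub
      ((h1.pow 2).inv (pow_ne_zero 2 (hkne 0 h0))))).const_mul (2 * b)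
    have h4 := (h3.congr_of_eventuallyEq (f₁ := deriv f) (by
      filter_upwards [hu'] with x hx
      rw [hf' x hx]; rfl)).deriv
    rw [h4]
    simp only [Pi.pow_apply, Pi.sub_apply, Pi.inv_apply, hk0]
    push_cast
    ring
  have hk'0 := hk'b 0 (mem_closedBall_self (by norm_num))
  have h5 : ‖deriv (deriv k) 0 * 4 - 32 * deriv k 0 ^ 2‖ ≤ 32 * 4 + 32 * 16 ^ 2 := by
    refine (norm_sub_le _ _).trans ?_
    rw [norm_mul, norm_mul, norm_pow]
    norm_num only [Complex.norm_ofNat]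
    nlinarith [norm_nonneg (deriv k 0)]
  rw [hf'', norm_mul, norm_mul, hbd]
  norm_num only [Complex.norm_ofNat] at h5 ⊢
  nlinarith [norm_nonneg (deriv (deriv k) 0 * 4 - 32 * deriv k 0 ^ 2)]

theorem exists_norm_deriv_deriv_le_halfPlane : ∃ C : ℝ, 0 < C ∧ ∀ (L : ℝ) (φ : ℂ → ℂ),
    DifferentiableOn ℂ φ {w | L < w.re} → InjOn φ {w | L < w.re} →
      ∀ w : ℂ, L < w.re → ‖deriv (deriv φ) w‖ ≤ C / (w.re - L) * ‖deriv φ w‖ := by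
  obtain ⟨C, hC, h⟩ := exists_norm_deriv_deriv_le_of_injOn
  refine ⟨C, hC, fun L φ hφ hi w hw => ?_⟩
  set r : ℝ := w.re - L with hr
  have hr0 : 0 < r := sub_pos.2 hw
  have hrc : (r : ℂ) ≠ 0 := ofReal_ne_zero.2 hr0.ne'
  have hm : MapsTo (fun u : ℂ => w + r * u) (ball 0 1) {w | L < w.re} := by
    intro u hu
    rw [mem_ball_zero_iff] at hu
    have h1 := (abs_le.1 (abs_re_le_norm u)).1
    simp only [mem_ofPred_eq, add_re, mul_re, ofReal_re, ofReal_im, zero_mul, sub_zero]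
    nlinarith
  have h1 := h (fun u => φ (w + r * u)) (hφ.comp (by fun_prop) hm) (by
    intro x hx y hy hxy
    have := hi (hm hx) (hm hy) hxy
    simpa [hrc] using this)
  have e1 : ∀ (ψ : ℂ → ℂ) (u : ℂ), deriv (fun u => ψ (w + r * u)) u = r * deriv ψ (w + r * u) := by
    intro ψ u
    have := deriv_comp_mul_left (r : ℂ) (fun v => ψ (w + v)) u
    rw [this, deriv_comp_const_add, smul_eq_mul]
  have e2 : deriv (fun u => φ (w + r * u)) = fun u => r * deriv φ (w + r * u) := funext (e1 φ)
  rw [e2, deriv_const_mul_field, e1 (deriv φ)] at h1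
  simp only [mul_zero, add_zero, norm_mul, norm_real, Real.norm_of_nonneg hr0.le] at h1
  rw [div_mul_eq_mul_div, le_div_iff₀ hr0]
  have h2 : r * (‖deriv (deriv φ) w‖ * r) ≤ r * (C * ‖deriv φ w‖) := by linarith
  exact le_of_mul_le_mul_left h2 hr0

theorem hasDerivAt_comp_add_ofReal {g : ℂ → ℂ} {g' w : ℂ} {u : ℝ} (h : HasDerivAt g g' (w + u)) :
    HasDerivAt (fun u : ℝ => g (w + u)) g' u := by
  have h1 : HasDerivAt (fun u : ℝ => w + (u : ℂ)) 1 u := ((hasDerivAt_id u).ofReal_comp).const_add w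
  have h2 := h.comp_of_eq u h1 rfl
  rwa [mul_one] at h2

section decay

variable {X : ℝ} {g : ℂ → ℂ}

theorem norm_add_ofReal_le (hg : DifferentiableOn ℂ g {w | X < w.re})
    (hgg : ∀ w : ℂ, X < w.re → ‖deriv g w + g w‖ ≤ 1 / 8 * ‖g w‖)
    {w : ℂ} (hw : X < w.re) {u : ℝ} (hu : 0 ≤ u) :
    ‖g (w + u)‖ ≤ ‖g w‖ * Real.exp (-(7 / 8) * u) := by
  have hmem : ∀ x : ℝ, 0 ≤ x → X < (w + x).re := fun x hx => by simp; linarith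
  have hd : ∀ x : ℝ, 0 ≤ x → HasDerivAt (fun x : ℝ => cexp x * g (w + x))
      (cexp x * (deriv g (w + x) + g (w + x))) x := by
    intro x hx
    have h1 := hasDerivAt_comp_add_ofReal (hg.differentiableAt
      ((isOpen_re_gt X).mem_nhds (hmem x hx))).hasDerivAt
    have h2 : HasDerivAt (fun x : ℝ => cexp x) (cexp x) x := by
      simpa using! (hasDerivAt_id x).ofReal_comp.cexp
    convert! h2.mul h1 using 1
    ring
  have h := norm_le_gronwallBound_of_norm_deriv_right_le (a := 0) (b := u) (δ := ‖g w‖)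
    (K := 1 / 8) (ε := 0) (f := fun x : ℝ => cexp x * g (w + x))
    (fun x hx => (hd x hx.1).continuousAt.continuousWithinAt)
    (fun x hx => (hd x hx.1).hasDerivWithinAt) (by simp) (fun x hx => by
      rw [norm_mul, norm_mul, add_zero]
      nlinarith [hgg _ (hmem x hx.1), norm_nonneg (cexp x)]) u ⟨hu, le_rfl⟩
  rw [gronwallBound_ε0, sub_zero, norm_mul, norm_exp_ofReal] at h
  have h3 : Real.exp (-(7 / 8) * u) = Real.exp (1 / 8 * u) * Real.exp (-u) := by
    rw [← Real.exp_add]; ring_nf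
  have h4 : Real.exp u * Real.exp (-u) = 1 := by rw [← Real.exp_add]; simp
  rw [h3]
  have h5 := mul_le_mul_of_nonneg_right h (Real.exp_pos (-u)).le
  calc ‖g (w + u)‖ = Real.exp u * ‖g (w + u)‖ * Real.exp (-u) := by linear_combination -‖g (w + u)‖ * h4
    _ ≤ _ := h5
    _ = _ := by ring

theorem norm_primitive_add_ofReal_sub_le (hg : DifferentiableOn ℂ g {w | X < w.re})
    (hgg : ∀ w : ℂ, X < w.re → ‖deriv g w + g w‖ ≤ 1 / 8 * ‖g w‖) {H : ℂ → ℂ}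
    (hH : ∀ w : ℂ, X < w.re → HasDerivAt H (deriv g w + g w) w)
    {w : ℂ} (hw : X < w.re) {u : ℝ} (hu : 0 ≤ u) :
    ‖H (w + u) - H w‖ ≤ 1 / 7 * ‖g w‖ := by
  have hmem : ∀ x : ℝ, 0 ≤ x → X < (w + x).re := fun x hx => by simp; linarith
  have hd : ∀ x : ℝ, 0 ≤ x → HasDerivAt (fun x : ℝ => H (w + x) - H w)
      (deriv g (w + x) + g (w + x)) x := fun x hx =>
    (hasDerivAt_comp_add_ofReal (hH _ (hmem x hx))).sub_const _
  have hB : ∀ x : ℝ, HasDerivAt (fun x : ℝ => 1 / 7 * ‖g w‖ * (1 - Real.exp (-(7 / 8) * x)))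
      (1 / 8 * (‖g w‖ * Real.exp (-(7 / 8) * x))) x := by
    intro x
    have h1 := ((((hasDerivAt_id x).const_mul (-(7 / 8))).exp).const_sub 1).const_mul
      (1 / 7 * ‖g w‖)
    convert! h1 using 1
    simp only [id, mul_one]
    ring
  have h := image_norm_le_of_norm_deriv_right_le_deriv_boundary (a := 0) (b := u)
    (fun x hx => (hd x hx.1).continuousAt.continuousWithinAt)
    (fun x hx => (hd x hx.1).hasDerivWithinAt) (by simp) hB (fun x hx => by
      refine (hgg _ (hmem x hx.1)).trans ?_
      have := norm_add_ofReal_le hg hgg hw hx.1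
      linarith) ⟨hu, le_rfl⟩
  refine h.trans ?_
  nlinarith [norm_nonneg (g w), Real.exp_pos (-(7 / 8) * u),
    mul_nonneg (norm_nonneg (g w)) (Real.exp_pos (-(7 / 8) * u)).le]

theorem exists_limit_primitive (hg : DifferentiableOn ℂ g {w | X < w.re})
    (hgg : ∀ w : ℂ, X < w.re → ‖deriv g w + g w‖ ≤ 1 / 8 * ‖g w‖) {H : ℂ → ℂ}
    (hH : ∀ w : ℂ, X < w.re → HasDerivAt H (deriv g w + g w) w) :
    ∃ c, ∀ w : ℂ, X < w.re → ‖c - H w‖ ≤ 1 / 7 * ‖g w‖ := by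
  have hexp : ∀ n : ℕ, Real.exp (-(7 / 8) * (n : ℝ)) = Real.exp (-(7 / 8)) ^ n := fun n => by
    rw [← Real.exp_nat_mul]; ring_nf
  have hr1 : Real.exp (-(7 / 8)) < 1 := by rw [← Real.exp_zero]; exact Real.exp_lt_exp.2 (by norm_num)
  have hmem : ∀ {w : ℂ}, X < w.re → ∀ n : ℕ, X < (w + (n : ℝ)).re := fun hw n => by
    have : (0 : ℝ) ≤ n := n.cast_nonneg
    simp
    linarith
  have hlim : ∀ w : ℂ, X < w.re → ∃ c, Tendsto (fun n : ℕ => H (w + (n : ℝ))) atTop (𝓝 c) := by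
    intro w hw
    refine cauchySeq_tendsto_of_complete
      (cauchySeq_of_le_geometric (Real.exp (-(7 / 8))) (1 / 7 * ‖g w‖) hr1 fun n => ?_)
    have h1 := norm_primitive_add_ofReal_sub_le hg hgg hH (hmem hw n) zero_le_one
    have h2 := norm_add_ofReal_le hg hgg hw (u := n) n.cast_nonneg
    rw [hexp] at h2
    rw [dist_comm, dist_eq_norm]
    have h3 : w + ((n + 1 : ℕ) : ℝ) = w + (n : ℝ) + ((1 : ℝ) : ℂ) := by push_cast; ring
    rw [h3]
    linarith
  set w₀ : ℂ := ((X + 1 : ℝ) : ℂ) with hw₀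
  have hw₀X : X < w₀.re := by simp [hw₀]
  obtain ⟨c, hc⟩ := hlim w₀ hw₀X
  refine ⟨c, fun w hw => ?_⟩
  obtain ⟨c', hc'⟩ := hlim w hw
  have hle : ‖c' - H w‖ ≤ 1 / 7 * ‖g w‖ :=
    le_of_tendsto ((hc'.sub_const (H w)).norm) (Eventually.of_forall fun n =>
      norm_primitive_add_ofReal_sub_le hg hgg hH hw n.cast_nonneg)
  suffices c = c' by rwa [this]
  have hseg : segment ℝ w₀ w ⊆ {w | X < w.re} := (convex_halfSpace_re_gt X).segment_subset hw₀X hw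
  have hcpt : IsCompact (segment ℝ w₀ w) := by
    rw [segment_eq_image_lineMap]
    exact isCompact_Icc.image AffineMap.lineMap_continuous
  obtain ⟨B, hB⟩ := hcpt.exists_bound_of_continuousOn
    (hg.continuousOn.mono hseg)
  have h0 : Tendsto (fun n : ℕ => H (w + (n : ℝ)) - H (w₀ + (n : ℝ))) atTop (𝓝 0) := by
    refine squeeze_zero_norm (a := fun n : ℕ => 1 / 8 * (B * Real.exp (-(7 / 8)) ^ n) * ‖w - w₀‖)
      (fun n => ?_) ?_
    · refine (convex_segment (𝕜 := ℝ) w₀ w).norm_image_sub_le_of_norm_hasDerivWithin_le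
        (f := fun v => H (v + (n : ℝ))) (𝕜 := ℂ)
        (f' := fun v => deriv g (v + (n : ℝ)) + g (v + (n : ℝ)))
        (fun v hv => ((hH _ (hmem (hseg hv) n)).comp_add_const v _).hasDerivWithinAt)
        (fun v hv => ?_) (left_mem_segment ℝ w₀ w) (right_mem_segment ℝ w₀ w)
      refine (hgg _ (hmem (hseg hv) n)).trans ?_
      have h2 := norm_add_ofReal_le hg hgg (hseg hv) (u := n) n.cast_nonneg
      rw [hexp] at h2
      have h3 := mul_le_mul_of_nonneg_right (hB v hv) (pow_pos (Real.exp_pos (-(7 / 8))) n).le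
      linarith
    · have := (tendsto_pow_atTop_nhds_zero_of_lt_one (Real.exp_pos (-(7 / 8))).le hr1)
      simpa only [mul_zero, zero_mul] using ((this.const_mul B).const_mul (1 / 8)).mul_const ‖w - w₀‖
  have h1 := tendsto_nhds_unique h0 (hc'.sub hc)
  exact (sub_eq_zero.1 h1.symm).symm

/-- If `g' + g` is small compared to `g` on a half-plane then `g` is the derivative of `-e^{-Q}`
with `Q` close to the identity. -/
theorem exists_log_primitive (hg : DifferentiableOn ℂ g {w | X < w.re})
    (hne : ∀ w : ℂ, X < w.re → g w ≠ 0)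
    (hgg : ∀ w : ℂ, X < w.re → ‖deriv g w + g w‖ ≤ 1 / 8 * ‖g w‖) :
    ∃ Q q : ℂ → ℂ, ∀ w : ℂ, X < w.re →
      HasDerivAt Q (q w) w ∧ ‖q w - 1‖ ≤ 1 / 3 ∧ q w * cexp (-Q w) = g w := by
  have hop := isOpen_re_gt X
  obtain ⟨G, hG⟩ := exists_primitive_halfPlane hg
  have hgd : ∀ w : ℂ, X < w.re → HasDerivAt g (deriv g w) w := fun w hw =>
    (hg.differentiableAt (hop.mem_nhds hw)).hasDerivAt
  obtain ⟨c, hc⟩ := exists_limit_primitive hg hgg (H := fun w => g w + G w)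
    fun w hw => (hgd w hw).add (hG w hw)
  set E : ℂ → ℂ := fun w => c - G w with hE
  have hEd : ∀ w : ℂ, X < w.re → HasDerivAt E (-g w) w := fun w hw => (hG w hw).const_sub c
  have hEg : ∀ w : ℂ, X < w.re → ‖E w - g w‖ ≤ 1 / 7 * ‖g w‖ := fun w hw => by
    have := hc w hw
    rwa [add_comm, ← sub_sub] at this
  have hgE : ∀ w : ℂ, X < w.re → 6 / 7 * ‖g w‖ ≤ ‖E w‖ := fun w hw => by
    have h1 := hEg w hw
    have h2 := norm_sub_norm_le (g w) (E w)
    rw [norm_sub_rev (g w)] at h2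
    linarith
  have hE0 : ∀ w : ℂ, X < w.re → E w ≠ 0 := fun w hw h0 => by
    have h1 := hgE w hw
    have h2 := norm_pos_iff.2 (hne w hw)
    rw [h0, norm_zero] at h1
    linarith
  have hEdo : DifferentiableOn ℂ E {w | X < w.re} := fun w hw =>
    (hEd w hw).differentiableAt.differentiableWithinAt
  obtain ⟨Q, hQ⟩ := exists_primitive_halfPlane (hg.div hEdo hE0)
  have hP : ∀ w : ℂ, X < w.re → HasDerivAt (fun w => E w * cexp (Q w)) 0 w := fun w hw => by
    convert! (hEd w hw).mul (hQ w hw).cexp using 1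
    have := hE0 w hw
    simp only [Pi.div_apply]
    field_simp
    ring
  set w₀ : ℂ := ((X + 1 : ℝ) : ℂ) with hw₀
  have hw₀X : X < w₀.re := by simp [hw₀]
  have hconst : ∀ w : ℂ, X < w.re → E w * cexp (Q w) = E w₀ * cexp (Q w₀) := fun w hw =>
    hop.is_const_of_deriv_eq_zero (convex_halfSpace_re_gt X).isPreconnected
      (fun v hv => (hP v hv).differentiableAt.differentiableWithinAt)
      (fun v hv => (hP v hv).deriv) hw hw₀X
  set K := E w₀ * cexp (Q w₀) with hK
  have hK0 : K ≠ 0 := mul_ne_zero (hE0 w₀ hw₀X) (exp_ne_zero _)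
  refine ⟨fun w => Q w - log K, fun w => g w / E w, fun w hw => ⟨(hQ w hw).sub_const _, ?_, ?_⟩⟩
  · have h1 : g w / E w - 1 = -(E w - g w) / E w := by
      have := hE0 w hw
      field_simp
      ring
    rw [h1, norm_div, norm_neg, div_le_iff₀ (norm_pos_iff.2 (hE0 w hw))]
    linarith [hEg w hw, hgE w hw, norm_nonneg (g w)]
  · have h1 : cexp (-(Q w - log K)) = E w := by
      rw [neg_sub, exp_sub, exp_log hK0, ← hconst w hw]
      field_simp [exp_ne_zero]
    rw [h1, div_mul_cancel₀ _ (hE0 w hw)]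

end decay

section nearId

variable {X : ℝ} {Q q : ℂ → ℂ}

theorem norm_sub_sub_sub_le (hQ : ∀ w : ℂ, X < w.re → HasDerivAt Q (q w) w)
    (hq : ∀ w : ℂ, X < w.re → ‖q w - 1‖ ≤ 1 / 3) {a b : ℂ} (ha : X < a.re) (hb : X < b.re) :
    ‖Q b - Q a - (b - a)‖ ≤ 1 / 3 * ‖b - a‖ := by
  have := (convex_halfSpace_re_gt X).norm_image_sub_le_of_norm_hasDerivWithin_le (𝕜 := ℂ)
    (f := fun w => Q w - w) (f' := fun w => q w - 1)
    (fun w hw => ((hQ w hw).sub (hasDerivAt_id w)).hasDerivWithinAt) (fun w hw => hq w hw) ha hb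
  rwa [show Q b - Q a - (b - a) = Q b - b - (Q a - a) by ring]

theorem injOn_of_norm_sub_one_le (hQ : ∀ w : ℂ, X < w.re → HasDerivAt Q (q w) w)
    (hq : ∀ w : ℂ, X < w.re → ‖q w - 1‖ ≤ 1 / 3) : InjOn Q {w | X < w.re} := by
  intro a ha b hb hab
  have := norm_sub_sub_sub_le hQ hq ha hb
  rw [hab, sub_self, zero_sub, norm_neg] at this
  have h0 : ‖b - a‖ = 0 := by linarith [norm_nonneg (b - a)]
  exact (sub_eq_zero.1 (norm_eq_zero.1 h0)).symm

theorem exists_eq_add_ofReal (hQ : ∀ w : ℂ, X < w.re → HasDerivAt Q (q w) w)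
    (hq : ∀ w : ℂ, X < w.re → ‖q w - 1‖ ≤ 1 / 3) {w₀ : ℂ} (hw₀ : X < w₀.re) {s : ℝ} (hs : 0 ≤ s) :
    ∃ w : ℂ, w₀.re + s / 2 ≤ w.re ∧ Q w = Q w₀ + s := by
  have hre : ∀ w ∈ closedBall (w₀ + s) (s / 2), w₀.re + s / 2 ≤ w.re := by
    intro w hw
    rw [mem_closedBall, dist_eq_norm] at hw
    have h1 := (abs_le.1 (abs_re_le_norm (w - (w₀ + s)))).1
    simp at h1
    linarith
  have hX : ∀ w ∈ closedBall (w₀ + s) (s / 2), X < w.re := fun w hw => by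
    linarith [hre w hw]
  have hcX : X < (w₀ + s).re := by simp; linarith
  set N : ℂ → ℂ := fun w => w - Q w + (Q w₀ + s) with hN
  have hm : MapsTo N (closedBall (w₀ + s) (s / 2)) (closedBall (w₀ + s) (s / 2)) := by
    intro w hw
    have h1 := norm_sub_sub_sub_le hQ hq (hX w hw) hcX
    have h2 := norm_sub_sub_sub_le hQ hq hw₀ hcX
    have h3 : ‖w₀ + s - w₀‖ = s := by simp [abs_of_nonneg hs]
    rw [mem_closedBall, dist_comm, dist_eq_norm] at hw
    rw [mem_closedBall, dist_eq_norm]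
    have h4 : N w - (w₀ + s) = (Q (w₀ + s) - Q w - (w₀ + s - w)) -
        (Q (w₀ + s) - Q w₀ - (w₀ + s - w₀)) := by simp only [hN]; ring
    rw [h4]
    rw [h3] at h2
    refine (norm_sub_le _ _).trans ?_
    linarith
  have hc : ContractingWith (1 / 3) (hm.restrict N _ _) := by
    refine ⟨by rw [div_lt_one] <;> norm_num, LipschitzWith.of_dist_le_mul fun a b => ?_⟩
    have h1 := norm_sub_sub_sub_le hQ hq (hX a a.2) (hX b b.2)
    rw [Subtype.dist_eq, Subtype.dist_eq, dist_eq_norm, dist_comm, dist_eq_norm]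
    refine le_of_eq_of_le ?_ (h1.trans_eq ?_)
    · congr 1
      simp only [MapsTo.val_restrict_apply, hN]
      ring
    · simp
  obtain ⟨w, hw, hfix, -⟩ := hc.exists_fixedPoint' isClosed_closedBall.isComplete hm
    (mem_closedBall_self (by linarith)) (edist_ne_top _ _)
  refine ⟨w, hre w hw, ?_⟩
  have : w - Q w + (Q w₀ + s) = w := hfix
  linear_combination -this

theorem exists_im_eq (hQ : ∀ w : ℂ, X < w.re → HasDerivAt Q (q w) w)
    (hq : ∀ w : ℂ, X < w.re → ‖q w - 1‖ ≤ 1 / 3) (y : ℝ) :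
    ∃ w₀ : ℂ, X < w₀.re ∧ (Q w₀).im = y := by
  set a : ℝ → ℂ := fun v => ((X + 1 : ℝ) : ℂ) + v * I with ha
  have haX : ∀ v, X < (a v).re := fun v => by simp [ha]
  have hc : Continuous fun v => (Q (a v)).im :=
    continuous_im.comp (continuous_iff_continuousAt.2 fun v =>
      ContinuousAt.comp (hQ _ (haX v)).continuousAt (by fun_prop))
  have hest : ∀ v, |(Q (a v)).im - (Q (a 0)).im - v| ≤ 1 / 3 * |v| := by
    intro v
    have h1 := norm_sub_sub_sub_le hQ hq (haX 0) (haX v)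
    have h2 : a v - a 0 = v * I := by simp [ha]
    rw [h2, norm_mul, norm_I, mul_one, norm_real, Real.norm_eq_abs] at h1
    have h3 := (abs_im_le_norm _).trans h1
    simpa using h3
  set v : ℝ := 3 * |y - (Q (a 0)).im| with hv
  have hv0 : 0 ≤ v := by positivity
  have h1 := abs_le.1 (hest v)
  have h2 := abs_le.1 (hest (-v))
  rw [abs_neg] at h2
  rw [abs_of_nonneg hv0] at h1 h2
  have h3 := le_abs_self (y - (Q (a 0)).im)
  have h4 := neg_abs_le (y - (Q (a 0)).im)
  obtain ⟨x, -, hx⟩ := intermediate_value_Icc (show -v ≤ v by linarith) hc.continuousOn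
    (show y ∈ _ from ⟨by linarith, by linarith⟩)
  exact ⟨a x, haX x, hx⟩

end nearId

/-- If `f = e^F` on `U` and `F` has a univalent inverse `φ` on a right half-plane then `f` is
locally bounded on `U` near every point at which it is meromorphic. -/
theorem exists_eventually_norm_le {f F φ : ℂ → ℂ} {U : Set ℂ} {L : ℝ} {p : ℂ}
    (hf : MeromorphicAt f p) (hUo : IsOpen U) (hF : ContinuousOn F U)
    (hfF : ∀ z ∈ U, f z = cexp (F z)) (hUF : ∀ z ∈ U, L < (F z).re ∧ φ (F z) = z)
    (hφ : ContinuousOn φ {w | L < w.re}) (hφU : ∀ w : ℂ, L < w.re → φ w ∈ U ∧ F (φ w) = w) :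
    ∃ R : ℝ, ∀ᶠ z in 𝓝 p, z ∈ U → ‖f z‖ ≤ R := by
  rcases lt_or_ge (meromorphicOrderAt f p) 0 with hord | hord
  swap
  · obtain ⟨c, hc⟩ := tendsto_nhds_of_meromorphicOrderAt_nonneg hf hord
    refine ⟨max (‖c‖ + 1) ‖f p‖, ?_⟩
    have h1 := hc.norm.eventually_lt_const (lt_add_one ‖c‖)
    rw [eventually_nhdsWithin_iff] at h1
    filter_upwards [h1] with z hz _
    by_cases hzp : z = p
    · rw [hzp]; exact le_max_right _ _
    · exact (hz hzp).le.trans (le_max_left _ _)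
  have hcob := (tendsto_cobounded_iff_meromorphicOrderAt_neg hf).2 hord
  have hnorm : Tendsto (fun z => ‖f z‖) (𝓝[≠] p) atTop := tendsto_norm_atTop_iff_cobounded.2 hcob
  have hpU : p ∉ U := by
    intro hp
    have h1 : ContinuousAt (fun z => cexp (F z)) p := (hF.continuousAt (hUo.mem_nhds hp)).cexp
    have h2 : Tendsto f (𝓝[≠] p) (𝓝 (cexp (F p))) := by
      refine (h1.tendsto.mono_left nhdsWithin_le_nhds).congr' ?_
      filter_upwards [nhdsWithin_le_nhds (hUo.mem_nhds hp)] with z hz using (hfF z hz).symm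
    exact not_tendsto_nhds_of_tendsto_atTop hnorm _ h2.norm
  have hev := hf.eventually_analyticAt.and (hnorm.eventually_gt_atTop 0)
  rw [eventually_nhdsWithin_iff] at hev
  obtain ⟨r₀, hr₀, hball⟩ := Metric.eventually_nhds_iff_ball.1 hev
  set g : ℂ → ℂ := Function.update (fun z => (f z)⁻¹) p 0 with hg
  have hgp : g p = 0 := by simp [hg]
  have hgne : ∀ z, z ≠ p → g z = (f z)⁻¹ := fun z hz => by simp [hg, hz]
  have hgd : DifferentiableOn ℂ g (ball p r₀) := by
    refine (differentiableOn_compl_singleton_and_continuousAt_iff (ball_mem_nhds p hr₀)).1 ⟨?_, ?_⟩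
    · rintro z ⟨hz, hzp⟩
      obtain ⟨h1, h2⟩ := hball z hz hzp
      refine DifferentiableAt.differentiableWithinAt ?_
      refine (h1.differentiableAt.inv (norm_pos_iff.1 h2)).congr_of_eventuallyEq ?_
      filter_upwards [isOpen_ne.mem_nhds hzp] with x hx using hgne x hx
    · rw [hg, continuousAt_update_same]
      exact tendsto_inv₀_cobounded.comp hcob
  set r := r₀ / 2 with hr
  have hr0 : 0 < r := half_pos hr₀
  have hrr : r < r₀ := half_lt_self hr₀
  obtain ⟨R, hR⟩ := (isCompact_sphere p r).exists_bound_of_continuousOn (f := f) fun z hz =>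
    ((hball z (by rw [mem_ball, mem_sphere.1 hz]; exact hrr) (by
      rintro rfl
      rw [mem_sphere, dist_self] at hz
      exact hr0.ne hz)).1.continuousAt).continuousWithinAt
  refine ⟨max R 1, ?_⟩
  filter_upwards [ball_mem_nhds p hr0] with z hz hzU
  by_contra hlt
  rw [not_le] at hlt
  have hpos : 0 < max R 1 := lt_max_of_lt_right one_pos
  set w₀ := F z with hw₀
  set L' := max L (Real.log (max R 1)) with hL'
  have hfφ : ∀ w : ℂ, L < w.re → f (φ w) = cexp w := fun w hw => by
    rw [hfF _ (hφU w hw).1, (hφU w hw).2]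
  have hLL : ∀ w : ℂ, L' < w.re → L < w.re := fun w hw => (le_max_left _ _).trans_lt hw
  have hw₀L : L' < w₀.re := by
    refine max_lt (hUF z hzU).1 ?_
    rwa [Real.log_lt_iff_lt_exp hpos, ← norm_exp, ← hfF z hzU]
  have hin : ∀ w : ℂ, L' < w.re → φ w ∈ ball p r := by
    intro w hw
    by_contra hwb
    rw [mem_ball, not_lt] at hwb
    have hdist : ContinuousOn (fun w => dist (φ w) p) {w | L' < w.re} :=
      (continuous_id.dist continuous_const).comp_continuousOn (hφ.mono fun w hw => hLL w hw)
    obtain ⟨v, hv, hvr⟩ := (convex_halfSpace_re_gt L').isPreconnected.intermediate_value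
      (f := fun w => dist (φ w) p) hw₀L hw
      hdist ⟨by
        simp only [hw₀, (hUF z hzU).2]; exact (mem_ball.1 hz).le, hwb⟩
    have h1 := hR (φ v) hvr
    rw [hfφ v (hLL v hv), norm_exp] at h1
    have h2 : Real.log (max R 1) < v.re := (le_max_right _ _).trans_lt hv
    rw [Real.log_lt_iff_lt_exp hpos] at h2
    exact absurd (h2.trans_le h1) (not_lt.2 (le_max_left _ _))
  set a : ℕ → ℂ := fun k => w₀ + k * (2 * Real.pi * I) with ha
  have haL : ∀ k, L' < (a k).re := fun k => by simpa [ha] using hw₀L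
  have hexp : ∀ k, cexp (a k) = cexp w₀ := fun k => by
    rw [ha]
    simp only
    rw [exp_add, exp_nat_mul_two_pi_mul_I, mul_one]
  have hinj : Function.Injective fun k => φ (a k) := by
    intro j k hjk
    have h1 := congrArg F hjk
    simp only [(hφU _ (hLL _ (haL _))).2] at h1
    have h2 : (2 * Real.pi * I : ℂ) ≠ 0 := two_pi_I_ne_zero
    simpa [ha, h2] using h1
  obtain ⟨x, hx, hacc⟩ := (infinite_range_of_injective hinj).exists_accPt_of_subset_isCompact
    (isCompact_closedBall p r) (by
      rintro _ ⟨k, rfl⟩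
      exact ball_subset_closedBall (hin _ (haL k)))
  have hfreq : ∃ᶠ y in 𝓝[≠] x, g y = cexp (-w₀) := by
    rw [accPt_iff_frequently_nhdsNE] at hacc
    refine hacc.mono ?_
    rintro _ ⟨k, rfl⟩
    have hk := hLL _ (haL k)
    rw [hgne _ fun h => hpU (h ▸ (hφU _ hk).1), hfφ _ hk, hexp, exp_neg]
  have heq := (hgd.analyticOnNhd isOpen_ball).eqOn_of_preconnected_of_frequently_eq
    analyticOnNhd_const (convex_ball p r₀).isPreconnected
    (closedBall_subset_ball hrr hx) hfreq (mem_ball_self hr₀)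
  rw [hgp] at heq
  exact exp_ne_zero _ heq.symm

/-- A conformal change of variable `Q` that turns the flow `ẇ = e^w / φ'(w)` on a right half-plane
into `ζ̇ = e^ζ`. -/
theorem exists_flow_linearization {φ : ℂ → ℂ} {L : ℝ} (hφ : DifferentiableOn ℂ φ {w | L < w.re})
    (hφi : InjOn φ {w | L < w.re}) :
    ∃ (X : ℝ) (Q q : ℂ → ℂ), L < X ∧ ∀ w : ℂ, X < w.re →
      HasDerivAt Q (q w) w ∧ ‖q w - 1‖ ≤ 1 / 3 ∧ deriv φ w = cexp w * (q w * cexp (-Q w)) := by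
  obtain ⟨C, hC, hCφ⟩ := exists_norm_deriv_deriv_le_halfPlane
  have hLX : L < L + 8 * C := by linarith
  have hsub : ∀ w : ℂ, L + 8 * C < w.re → L < w.re := fun w hw => hLX.trans hw
  have hd : DifferentiableOn ℂ (deriv φ) {w | L < w.re} := hφ.deriv (isOpen_re_gt L)
  have hd' : ∀ w : ℂ, L + 8 * C < w.re → HasDerivAt (fun w => deriv φ w * cexp (-w))
      (deriv (deriv φ) w * cexp (-w) + deriv φ w * (cexp (-w) * -1)) w := fun w hw =>
    ((hd.differentiableAt ((isOpen_re_gt L).mem_nhds (hsub w hw))).hasDerivAt).mul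
      ((hasDerivAt_id w).neg.cexp)
  obtain ⟨Q, q, hQ⟩ := exists_log_primitive (X := L + 8 * C) (g := fun w => deriv φ w * cexp (-w))
    (fun w hw => (hd' w hw).differentiableAt.differentiableWithinAt)
    (fun w hw => mul_ne_zero ((injOn_inverse (isOpen_re_gt L) hφ hφi).2.1 w (hsub w hw))
      (exp_ne_zero _))
    (fun w hw => by
      have h1 := hCφ L φ hφ hφi w (hsub w hw)
      have h2 : C / (w.re - L) ≤ 1 / 8 := by
        rw [div_le_div_iff₀ (by linarith [hsub w hw]) (by norm_num)]
        linarith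
      rw [(hd' w hw).deriv, show deriv (deriv φ) w * cexp (-w) + deriv φ w * (cexp (-w) * -1) +
        deriv φ w * cexp (-w) = deriv (deriv φ) w * cexp (-w) by ring, norm_mul, norm_mul,
        ← mul_assoc]
      refine mul_le_mul_of_nonneg_right (h1.trans ?_) (norm_nonneg _)
      exact mul_le_mul_of_nonneg_right h2 (norm_nonneg _))
  refine ⟨L + 8 * C, Q, q, hLX, fun w hw => ?_⟩
  obtain ⟨h1, h2, h3⟩ := hQ w hw
  refine ⟨h1, h2, ?_⟩
  rw [h3, mul_left_comm, ← exp_add, add_neg_cancel, exp_zero, mul_one]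

/-- Trajectories of `ẇ = e^w / φ'(w)`, pushed forward by `φ`. -/
theorem exists_trajectories_of_injOn {φ : ℂ → ℂ} {L : ℝ} (hφ : DifferentiableOn ℂ φ {w | L < w.re})
    (hφi : InjOn φ {w | L < w.re}) :
    ∃ (V : ℕ → ℝ → ℂ) (α : ℕ → ℝ), (∀ k, α k < 0) ∧
      (∀ k, ∀ t ∈ Ioo (α k) 0, L < (V k t).re ∧
        HasDerivAt (fun s => φ (V k s)) (cexp (V k t)) t) ∧
      (∀ k, Tendsto (fun t => (V k t).re) (𝓝[<] 0) atTop) ∧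
      (∀ j k, j ≠ k → ∀ s ∈ Ioo (α j) 0, ∀ t ∈ Ioo (α k) 0, V j s ≠ V k t) := by
  obtain ⟨X, Q, q, hLX, h⟩ := exists_flow_linearization hφ hφi
  have hQ : ∀ w : ℂ, X < w.re → HasDerivAt Q (q w) w := fun w hw => (h w hw).1
  have hq : ∀ w : ℂ, X < w.re → ‖q w - 1‖ ≤ 1 / 3 := fun w hw => (h w hw).2.1
  have hQi : InjOn Q {w | X < w.re} := injOn_of_norm_sub_one_le hQ hq
  have hQd : DifferentiableOn ℂ Q {w | X < w.re} := fun w hw =>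
    (hQ w hw).differentiableAt.differentiableWithinAt
  obtain ⟨hVo, hQ0, hinv⟩ := injOn_inverse (isOpen_re_gt X) hQd hQi
  set W := Function.invFunOn Q {w | X < w.re}
  have hWQ : ∀ w : ℂ, X < w.re → W (Q w) = w := fun w hw => hQi.leftInvOn_invFunOn hw
  have hWd := hinv W hWQ
  choose w₀ hw₀X hw₀ using fun k : ℕ => exists_im_eq hQ hq (k * (2 * Real.pi))
  set ζ : ℕ → ℝ → ℂ := fun k t => -Real.log (-t) + k * (2 * Real.pi * I) with hζ
  set α : ℕ → ℝ := fun k => -Real.exp (-(Q (w₀ k)).re) with hα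
  have hα0 : ∀ k, α k < 0 := fun k => neg_lt_zero.2 (Real.exp_pos _)
  have hlog : ∀ k, ∀ t ∈ Ioo (α k) 0, (Q (w₀ k)).re < -Real.log (-t) := by
    intro k t ht
    rw [lt_neg, Real.log_lt_iff_lt_exp (neg_pos.2 ht.2)]
    exact neg_lt.1 ht.1
  have key : ∀ k, ∀ t ∈ Ioo (α k) 0, ∃ w : ℂ,
      (w₀ k).re + (-Real.log (-t) - (Q (w₀ k)).re) / 2 ≤ w.re ∧ X < w.re ∧ Q w = ζ k t := by
    intro k t ht
    obtain ⟨w, hw, hwQ⟩ := exists_eq_add_ofReal hQ hq (hw₀X k) (sub_pos.2 (hlog k t ht)).le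
    refine ⟨w, hw, ?_, ?_⟩
    · linarith [hlog k t ht, hw₀X k]
    · rw [hwQ]
      apply Complex.ext <;> simp [hζ, hw₀]
  have hVw : ∀ k t (w : ℂ), X < w.re → Q w = ζ k t → W (ζ k t) = w := fun k t w hw hQw => by
    rw [← hQw, hWQ w hw]
  have hζexp : ∀ k, ∀ t < (0 : ℝ), cexp (-ζ k t) = -t := by
    intro k t ht
    simp only [hζ]
    rw [neg_add, neg_neg, exp_add, ← ofReal_exp, Real.exp_log (neg_pos.2 ht), exp_neg,
      exp_nat_mul_two_pi_mul_I]
    simp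
  refine ⟨fun k t => W (ζ k t), α, hα0, ?_, ?_, ?_⟩
  · intro k t ht
    obtain ⟨w, -, hw, hQw⟩ := key k t ht
    have hwt := hVw k t w hw hQw
    have ht0 : t ≠ 0 := ht.2.ne
    have hqw : q w ≠ 0 := (hQ w hw).deriv ▸ hQ0 w hw
    have h1 : HasDerivAt (ζ k) (-((-t)⁻¹ * -1 : ℝ) : ℂ) t := by
      have := ((Real.hasDerivAt_log (neg_ne_zero.2 ht0)).comp t (hasDerivAt_neg t)).ofReal_comp
      exact (this.neg).add_const _
    have hWdiff : DifferentiableAt ℂ W (ζ k t) :=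
      hWd.differentiableAt (hVo.mem_nhds ⟨w, hw, hQw⟩)
    have h2 : HasDerivAt W (q w)⁻¹ (ζ k t) := by
      have h3 : HasDerivAt (fun v => W (Q v)) (deriv W (ζ k t) * q w) w := by
        rw [← hQw] at hWdiff ⊢
        exact hWdiff.hasDerivAt.comp w (hQ w hw)
      have h4 : HasDerivAt (fun v => W (Q v)) 1 w :=
        (hasDerivAt_id w).congr_of_eventuallyEq <| by
          filter_upwards [(isOpen_re_gt X).mem_nhds hw] with v hv using hWQ v hv
      rw [← eq_inv_of_mul_eq_one_left (h3.unique h4)]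
      exact hWdiff.hasDerivAt
    have h5 : HasDerivAt φ (deriv φ w) (W (ζ k t)) := by
      rw [hwt]
      exact (hφ.differentiableAt ((isOpen_re_gt L).mem_nhds (hLX.trans hw))).hasDerivAt
    refine ⟨by simp only [hwt]; exact hLX.trans hw, ?_⟩
    simp only [hwt]
    refine ((h5.comp (ζ k t) h2).comp t h1).congr_deriv ?_
    rw [(h w hw).2.2, hQw, hζexp k t ht.2]
    have : (t : ℂ) ≠ 0 := ofReal_ne_zero.2 ht0
    push_cast
    field_simp
  · intro k
    have h1 : Tendsto (fun t : ℝ => -Real.log (-t)) (𝓝[<] 0) atTop := by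
      simp only [Real.log_neg_eq_log]
      exact tendsto_neg_atBot_atTop.comp
        (Real.tendsto_log_nhdsNE_zero.mono_left (nhdsWithin_mono _ fun t ht => ne_of_lt ht))
    have h2 : Tendsto (fun t : ℝ => (w₀ k).re + (-Real.log (-t) - (Q (w₀ k)).re) / 2) (𝓝[<] 0)
        atTop :=
      tendsto_atTop_add_const_left _ _ ((tendsto_atTop_add_const_right _ _ h1).atTop_div_const
        two_pos)
    refine tendsto_atTop_mono' _ ?_ h2
    filter_upwards [Ioo_mem_nhdsLT (hα0 k)] with t ht
    obtain ⟨w, hwre, hw, hQw⟩ := key k t ht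
    rwa [hVw k t w hw hQw]
  · intro j k hjk s hs t ht heq
    obtain ⟨w, -, hw, hQw⟩ := key j s hs
    obtain ⟨v, -, hv, hQv⟩ := key k t ht
    simp only [hVw j s w hw hQw, hVw k t v hv hQv] at heq
    have h1 : ζ j s = ζ k t := by rw [← hQw, ← hQv, heq]
    have h2 := congrArg im h1
    simp [hζ, Real.pi_ne_zero] at h2
    exact hjk h2

end HalfPlane


/-- Theorem 3: let `f` be meromorphic on a domain `Ω`, and suppose there are `M > 0`,
a subdomain `U ⊆ Ω` and an analytic `F : U → ℂ` with `f = e^F` on `U`, such that `F`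
maps `U` univalently onto the half-plane `{Re w > log M}`. Then `ż = f(z)` has
infinitely many pairwise disjoint trajectories each tending in finite increasing time
from within `U` to the extended boundary of `Ω` (i.e. eventually in `U` and outside
any compact subset of `Ω`). -/
theorem stmt14 (f F : ℂ → ℂ) (Ω U : Set ℂ) (M : ℝ) (hM : 0 < M)
    (hΩo : IsOpen Ω) (hΩc : IsConnected Ω)
    (hUo : IsOpen U) (hUc : IsConnected U) (hUΩ : U ⊆ Ω)
    (hf : MeromorphicOn f Ω)
    (hF : DifferentiableOn ℂ F U) (hfF : ∀ w ∈ U, f w = Complex.exp (F w))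
    (hFi : Set.InjOn F U) (hFim : F '' U = {w : ℂ | Real.log M < w.re}) :
    ∃ (S : ℕ → ℝ → ℂ) (α T : ℕ → ℝ),
      (∀ k, α k < T k) ∧
      (∀ k, ∀ t ∈ Set.Ioo (α k) (T k), S k t ∈ Ω ∧ HasDerivAt (S k) (f (S k t)) t) ∧
      (∀ k, ∀ K : Set ℂ, IsCompact K → K ⊆ Ω →
        ∃ t₀ ∈ Set.Ioo (α k) (T k), ∀ t, t₀ < t → t < T k → S k t ∈ U \ K) ∧
      (∀ j k, j ≠ k → ∀ s ∈ Set.Ioo (α j) (T j), ∀ t ∈ Set.Ioo (α k) (T k),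
        S j s ≠ S k t) := by
  set L := Real.log M
  set φ := Function.invFunOn F U
  have hφF : ∀ z ∈ U, φ (F z) = z := fun z hz => hFi.leftInvOn_invFunOn hz
  have hUF : ∀ z ∈ U, L < (F z).re ∧ φ (F z) = z := fun z hz =>
    ⟨hFim.subset (Set.mem_image_of_mem F hz), hφF z hz⟩
  have hφU : ∀ w : ℂ, L < w.re → φ w ∈ U ∧ F (φ w) = w := fun w hw => by
    obtain ⟨z, hz, rfl⟩ := hFim.superset hw
    rw [hφF z hz]
    exact ⟨hz, rfl⟩
  have hφ : DifferentiableOn ℂ φ {w | L < w.re} :=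
    hFim ▸ (injOn_inverse hUo hF hFi).2.2 φ hφF
  have hφi : Set.InjOn φ {w | L < w.re} := fun a ha b hb hab => by
    rw [← (hφU a ha).2, ← (hφU b hb).2, hab]
  obtain ⟨V, α, hα, hV, hVlim, hVdisj⟩ := exists_trajectories_of_injOn hφ hφi
  refine ⟨fun k t => φ (V k t), α, fun _ => 0, hα, fun k t ht => ?_, fun k K hK hKΩ => ?_,
    fun j k hjk s hs t ht heq => ?_⟩
  · obtain ⟨h1, h2⟩ := hV k t ht
    refine ⟨hUΩ (hφU _ h1).1, ?_⟩
    rwa [hfF _ (hφU _ h1).1, (hφU _ h1).2]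
  · obtain ⟨R, hR⟩ : ∃ R : ℝ, ∀ z ∈ K, z ∈ U → ‖f z‖ ≤ R := by
      refine hK.induction_on (p := fun K => ∃ R : ℝ, ∀ z ∈ K, z ∈ U → ‖f z‖ ≤ R) ⟨0, by simp⟩
        (fun s t hst ⟨R, hR⟩ => ⟨R, fun z hz => hR z (hst hz)⟩)
        (fun s t ⟨R, hR⟩ ⟨R', hR'⟩ => ⟨max R R', ?_⟩) (fun p hp => ?_)
      · rintro z (hz | hz) hzU
        exacts [le_max_of_le_left (hR z hz hzU), le_max_of_le_right (hR' z hz hzU)]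
      · obtain ⟨R, hR⟩ := exists_eventually_norm_le (hf p (hKΩ hp)) hUo hF.continuousOn hfF hUF
          hφ.continuousOn hφU
        exact ⟨_, mem_nhdsWithin_of_mem_nhds hR, R, fun z hz => hz⟩
    obtain ⟨t₁, ht₁, ht₁V⟩ := mem_nhdsLT_iff_exists_Ioo_subset.1
      ((hVlim k).eventually_gt_atTop (Real.log (max R 1)))
    have hmem : (max t₁ (α k / 2)) ∈ Set.Ioo (α k) 0 := by
      have := hα k
      exact ⟨lt_max_of_lt_right (by linarith), max_lt ht₁ (by linarith)⟩
    refine ⟨_, hmem, fun t ht ht0 => ?_⟩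
    have hVt := (hV k t ⟨hmem.1.trans ht, ht0⟩).1
    refine ⟨(hφU _ hVt).1, fun htK => ?_⟩
    have h1 := hR _ htK (hφU _ hVt).1
    rw [hfF _ (hφU _ hVt).1, (hφU _ hVt).2, Complex.norm_exp] at h1
    have h2 : Real.log (max R 1) < (V k t).re := ht₁V ⟨(le_max_left _ _).trans_lt ht, ht0⟩
    rw [Real.log_lt_iff_lt_exp (lt_max_of_lt_right one_pos)] at h2
    exact absurd (h2.trans_le h1) (not_lt.2 (le_max_left _ _))
  · exact hVdisj j k hjk s hs t ht (hφi (hV j s hs).1 (hV k t ht).1 heq)
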